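/- arXiv:1006.4290 — 2 statements merged into one kernel-verified Lean document; each statement's English description precedes it below -/
import Mathlib

section
/- Let R be a commutative ring having Property (A) and let B be a content R-algebra. Then Z(B) is a finite union of prime ideals each belonging to Min(B) if and only if Z(R) is a finite union of prime ideals each belonging to Min(R). -/
/-- The content `c(f)` of an element `f` of a commutative `R`-algebra `B`: the
intersection of all ideals `I` of `R` with `f ∈ IB`. -/
def contentIdeal (R : Type*) {B : Type*} [CommRing R] [CommRing B] [Algebra R B]
    (f : B) : Ideal R :=
  sInf {I : Ideal R | f ∈ I • (⊤ : Submodule R B)}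

/-- `B` is a content `R`-algebra: (i) `f ∈ c(f)B` for all `f`; (ii) `c(rf) = r·c(f)`
and the ideal generated by all the contents is `R`; (iii) the Dedekind–Mertens content
formula holds. -/
structure IsContentAlgebra (R B : Type*) [CommRing R] [CommRing B] [Algebra R B] : Prop where
  mem_content_smul : ∀ f : B, f ∈ contentIdeal R f • (⊤ : Submodule R B)
  content_smul : ∀ (r : R) (f : B),
    contentIdeal R (algebraMap R B r * f) = Ideal.span {r} * contentIdeal R f
  content_top : (⨆ f : B, contentIdeal R f) = ⊤
  dedekind_mertens : ∀ f g : B, ∃ n : ℕ, 1 ≤ n ∧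
    contentIdeal R f ^ n * contentIdeal R g =
      contentIdeal R f ^ (n - 1) * contentIdeal R (f * g)

/-- The set of zero-divisors of `R`. -/
def zdSet (R : Type*) [CommRing R] : Set R := {r : R | ∃ s : R, s ≠ 0 ∧ r * s = 0}

/-- `R` has Property (A): every finitely generated ideal consisting of zero-divisors has
a nonzero annihilator. -/
def PropertyA (R : Type*) [CommRing R] : Prop :=
  ∀ I : Ideal R, I.FG → (I : Set R) ⊆ zdSet R → ∃ r : R, r ≠ 0 ∧ ∀ x ∈ I, r * x = 0

namespace IsContentAlgebra

variable {R B : Type*} [CommRing R] [CommRing B] [Algebra R B]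

theorem contentIdeal_le_iff (hB : IsContentAlgebra R B) {f : B} {I : Ideal R} :
    contentIdeal R f ≤ I ↔ f ∈ I.map (algebraMap R B) := by
  have key : f ∈ I.map (algebraMap R B) ↔ f ∈ I • (⊤ : Submodule R B) := by
    rw [Ideal.smul_top_eq_map, Submodule.restrictScalars_mem]
  rw [key]
  exact ⟨fun h => Submodule.smul_mono_left h (hB.mem_content_smul f), fun h => sInf_le h⟩

theorem contentIdeal_eq_bot_iff (hB : IsContentAlgebra R B) {f : B} :
    contentIdeal R f = ⊥ ↔ f = 0 := by
  rw [← le_bot_iff, hB.contentIdeal_le_iff, Ideal.map_bot, Ideal.mem_bot]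

theorem contentIdeal_fg (hB : IsContentAlgebra R B) (f : B) : (contentIdeal R f).FG := by
  have hf : f ∈ Submodule.span B (algebraMap R B '' (contentIdeal R f : Set R)) :=
    hB.contentIdeal_le_iff.mp le_rfl
  obtain ⟨S, hS, c, hc⟩ := Submodule.mem_span_image_iff_exists_fun B |>.mp hf
  refine ⟨S, le_antisymm (Ideal.span_le.mpr hS) ?_⟩
  rw [hB.contentIdeal_le_iff, ← hc]
  exact Ideal.sum_mem _ fun i _ => Ideal.mul_mem_left _ _
    (Ideal.mem_map_of_mem _ (Ideal.subset_span i.2))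

theorem algebraMap_mul_eq_zero_iff (hB : IsContentAlgebra R B) {r : R} {f : B} :
    algebraMap R B r * f = 0 ↔ ∀ x ∈ contentIdeal R f, r * x = 0 := by
  rw [← hB.contentIdeal_eq_bot_iff, hB.content_smul, ← le_bot_iff,
    Ideal.span_singleton_mul_le_iff]
  rfl

theorem mem_of_forall_content (hB : IsContentAlgebra R B) {r : R} {I : Ideal R}
    (h : ∀ f : B, algebraMap R B r * f ∈ I.map (algebraMap R B)) : r ∈ I := by
  have hle : (⨆ f : B, contentIdeal R f) ≤ I.colon {r} := by
    refine iSup_le fun f x hx => ?_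
    have := hB.contentIdeal_le_iff.mpr (h f)
    rw [hB.content_smul, Ideal.span_singleton_mul_le_iff] at this
    rw [Submodule.mem_colon_singleton, smul_eq_mul, mul_comm]
    exact this x hx
  rw [hB.content_top] at hle
  simpa [Submodule.mem_colon_singleton] using hle (Submodule.mem_top (x := (1 : R)))

theorem comap_map (hB : IsContentAlgebra R B) (I : Ideal R) :
    (I.map (algebraMap R B)).comap (algebraMap R B) = I :=
  le_antisymm (fun _ hr => hB.mem_of_forall_content fun f => Ideal.mul_mem_right f _ hr)
    Ideal.le_comap_map

theorem algebraMap_injective (hB : IsContentAlgebra R B) :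
    Function.Injective (algebraMap R B) := by
  rw [RingHom.injective_iff_ker_eq_bot, RingHom.ker]
  simpa using hB.comap_map ⊥

theorem isPrime_map (hB : IsContentAlgebra R B) (p : Ideal R) [hp : p.IsPrime] :
    (p.map (algebraMap R B)).IsPrime := by
  refine ⟨fun h => hp.ne_top ?_, fun {f g} hfg => ?_⟩
  · rw [← hB.comap_map p, h, Ideal.comap_top]
  · rw [← hB.contentIdeal_le_iff] at hfg
    rw [← hB.contentIdeal_le_iff, ← hB.contentIdeal_le_iff]
    obtain ⟨n, -, hn⟩ := hB.dedekind_mertens f g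
    have hle : contentIdeal R f ^ n * contentIdeal R g ≤ p :=
      hn.trans_le (Ideal.mul_le_right.trans hfg)
    exact (hp.mul_le.mp hle).imp_left hp.le_of_pow_le

theorem map_mem_minimalPrimes (hB : IsContentAlgebra R B) {p : Ideal R}
    (hp : p ∈ minimalPrimes R) : p.map (algebraMap R B) ∈ minimalPrimes B := by
  have : p.IsPrime := hp.1.1
  refine ⟨⟨hB.isPrime_map p, bot_le⟩, fun Q ⟨hQ, _⟩ hle => ?_⟩
  rw [Ideal.map_le_iff_le_comap]
  exact hp.2 ⟨hQ.comap _, bot_le⟩ ((Ideal.comap_mono hle).trans_eq (hB.comap_map p))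

theorem comap_mem_minimalPrimes (hB : IsContentAlgebra R B) {Q : Ideal B}
    (hQ : Q ∈ minimalPrimes B) : Q.comap (algebraMap R B) ∈ minimalPrimes R := by
  have : Q.IsPrime := hQ.1.1
  refine ⟨⟨Q.comap_isPrime _, bot_le⟩, fun p ⟨hp, _⟩ hle => ?_⟩
  have hQp := hQ.2 ⟨hB.isPrime_map p, bot_le⟩ (Ideal.map_le_iff_le_comap.mpr hle)
  exact (Ideal.comap_mono hQp).trans_eq (hB.comap_map p)

/-- McCoy's theorem for content algebras. -/
theorem mem_zdSet_iff (hB : IsContentAlgebra R B) {f : B} :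
    f ∈ zdSet B ↔ ∃ r : R, r ≠ 0 ∧ ∀ x ∈ contentIdeal R f, r * x = 0 := by
  classical
  constructor
  · rintro ⟨g, hg, hfg⟩
    have hex : ∃ n, contentIdeal R f ^ n * contentIdeal R g = ⊥ := by
      obtain ⟨n, -, hn⟩ := hB.dedekind_mertens f g
      exact ⟨n, by rw [hn, hfg, hB.contentIdeal_eq_bot_iff.mpr rfl, Ideal.mul_bot]⟩
    obtain ⟨m, hm⟩ : ∃ m, Nat.find hex = m + 1 := by
      refine Nat.exists_eq_succ_of_ne_zero fun h0 => hg ?_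
      have := Nat.find_spec hex
      rwa [h0, pow_zero, Ideal.one_eq_top, Ideal.top_mul, hB.contentIdeal_eq_bot_iff] at this
    obtain ⟨r, hr, hr0⟩ := Submodule.exists_mem_ne_zero_of_ne_bot
      (Nat.find_min hex (m := m) (by omega))
    refine ⟨r, hr0, fun x hx => ?_⟩
    have hspec := Nat.find_spec hex
    rw [hm, pow_succ', mul_assoc] at hspec
    rw [← Ideal.mem_bot, ← hspec, mul_comm r x]
    exact Ideal.mul_mem_mul hx hr
  · rintro ⟨r, hr0, hr⟩
    refine ⟨algebraMap R B r, fun h => hr0 (hB.algebraMap_injective (by rw [h, map_zero])), ?_⟩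
    rw [mul_comm]
    exact hB.algebraMap_mul_eq_zero_iff.mpr hr

theorem mem_zdSet_iff_of_propertyA (hB : IsContentAlgebra R B) (hA : PropertyA R) {f : B} :
    f ∈ zdSet B ↔ (contentIdeal R f : Set R) ⊆ zdSet R := by
  rw [hB.mem_zdSet_iff]
  refine ⟨fun ⟨r, hr0, hr⟩ x hx => ⟨r, hr0, ?_⟩, hA _ (hB.contentIdeal_fg f)⟩
  rw [mul_comm, hr x hx]

theorem algebraMap_mem_zdSet_iff (hB : IsContentAlgebra R B) {r : R} :
    algebraMap R B r ∈ zdSet B ↔ r ∈ zdSet R := by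
  constructor
  · rintro ⟨g, hg, hrg⟩
    obtain ⟨s, hs, hs0⟩ := Submodule.exists_mem_ne_zero_of_ne_bot
      (mt hB.contentIdeal_eq_bot_iff.mp hg)
    exact ⟨s, hs0, hB.algebraMap_mul_eq_zero_iff.mp hrg s hs⟩
  · rintro ⟨s, hs0, hs⟩
    exact ⟨algebraMap R B s, fun h => hs0 (hB.algebraMap_injective (by rw [h, map_zero])),
      by rw [← map_mul, hs, map_zero]⟩

end IsContentAlgebra

/-- Let `R` have Property (A) and `B` be a content `R`-algebra. Then `Z(B)` is a finite
union of primes belonging to `Min(B)` iff `Z(R)` is a finite union of primes belonging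
to `Min(R)`. -/
theorem zdSet_finite_union_minimalPrimes_iff
    (R B : Type*) [CommRing R] [CommRing B] [Algebra R B]
    (hA : PropertyA R) (hB : IsContentAlgebra R B) :
    (∃ (n : ℕ) (Q : Fin n → Ideal B), (∀ i, Q i ∈ minimalPrimes B) ∧
        zdSet B = ⋃ i, (Q i : Set B)) ↔
    (∃ (n : ℕ) (p : Fin n → Ideal R), (∀ i, p i ∈ minimalPrimes R) ∧
        zdSet R = ⋃ i, (p i : Set R)) := by
  constructor
  · rintro ⟨n, Q, hQ, hZ⟩
    refine ⟨n, fun i => (Q i).comap (algebraMap R B),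
      fun i => hB.comap_mem_minimalPrimes (hQ i), ?_⟩
    ext r
    rw [← hB.algebraMap_mem_zdSet_iff, hZ]
    simp
  · rintro ⟨n, p, hp, hZ⟩
    refine ⟨n, fun i => (p i).map (algebraMap R B),
      fun i => hB.map_mem_minimalPrimes (hp i), ?_⟩
    ext f
    rw [hB.mem_zdSet_iff_of_propertyA hA, hZ, Set.mem_iUnion]
    simp only [SetLike.mem_coe, ← hB.contentIdeal_le_iff]
    refine ⟨fun hle => ?_, fun ⟨i, hi⟩ x hx => Set.mem_iUnion.mpr ⟨i, hi hx⟩⟩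
    obtain ⟨i, -⟩ := Set.mem_iUnion.mp (hle (zero_mem (contentIdeal R f)))
    simpa using (Ideal.subset_union_prime (s := Finset.univ) (f := p) i i
      fun j _ _ _ => (hp j).1.1).mp (by simpa using hle)
end

section
/- Let B be a content R-algebra such that the content function of B is onto. Then B is primal if and only if R is primal and R has Property (A). -/
/-- `R` is a primal ring: its set of zero-divisors is an ideal. -/
def PrimalRing (R : Type*) [CommRing R] : Prop :=
  ∃ I : Ideal R, (I : Set R) = zdSet R

theorem contentIdeal_le {R B : Type*} [CommRing R] [CommRing B] [Algebra R B] {I : Ideal R}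
    {f : B} (h : f ∈ I • (⊤ : Submodule R B)) : contentIdeal R f ≤ I :=
  sInf_le h

theorem contentIdeal_zero (R B : Type*) [CommRing R] [CommRing B] [Algebra R B] :
    contentIdeal R (0 : B) = ⊥ :=
  le_bot_iff.mp (contentIdeal_le (Submodule.zero_mem _))

/-- An element of `IB` already lies in `JB` for a finitely generated ideal `J ≤ I`. -/
theorem exists_fg_le_mem_smul_top {R M : Type*} [CommRing R] [AddCommGroup M] [Module R M]
    {I : Ideal R} {f : M} (hf : f ∈ I • (⊤ : Submodule R M)) :
    ∃ J : Ideal R, J.FG ∧ J ≤ I ∧ f ∈ J • (⊤ : Submodule R M) := by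
  induction hf using Submodule.smul_induction_on' with
  | smul r hr m hm =>
    refine ⟨Ideal.span {r}, Submodule.fg_span_singleton r, ?_, ?_⟩
    · simpa [Ideal.span_singleton_le_iff_mem] using hr
    · exact Submodule.smul_mem_smul (Ideal.mem_span_singleton_self r) hm
  | add x _ y _ hx hy =>
    obtain ⟨J, hJ, hJI, hxJ⟩ := hx
    obtain ⟨K, hK, hKI, hyK⟩ := hy
    exact ⟨J ⊔ K, Submodule.FG.sup hJ hK, sup_le hJI hKI,
      Submodule.add_mem _ (Submodule.smul_mono_left le_sup_left hxJ)
        (Submodule.smul_mono_left le_sup_right hyK)⟩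

theorem smul_eq_zero_of_mem_smul_top {R M : Type*} [CommRing R] [AddCommGroup M] [Module R M]
    {I : Ideal R} {r : R} (hr : ∀ x ∈ I, r * x = 0) {f : M}
    (hf : f ∈ I • (⊤ : Submodule R M)) : r • f = 0 := by
  induction hf using Submodule.smul_induction_on' with
  | smul s hs m _ => rw [smul_smul, hr s hs, zero_smul]
  | add x _ y _ hx hy => rw [smul_add, hx, hy, add_zero]

namespace IsContentAlgebra

variable {R B : Type*} [CommRing R] [CommRing B] [Algebra R B]

theorem contentIdeal_ne_bot (hB : IsContentAlgebra R B) {f : B} (hf : f ≠ 0) :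
    contentIdeal R f ≠ ⊥ := by
  intro h
  have := hB.mem_content_smul f
  rw [h, Submodule.bot_smul, Submodule.mem_bot] at this
  exact hf this

theorem algebraMap_ne_zero (hB : IsContentAlgebra R B) {r : R} (hr : r ≠ 0) :
    algebraMap R B r ≠ 0 := by
  intro h
  have hspan : Ideal.span {r} * (⨆ f : B, contentIdeal R f) = ⊥ := by
    rw [Ideal.mul_iSup, iSup_eq_bot]
    intro f
    rw [← hB.content_smul, h, zero_mul, contentIdeal_zero]
  rw [hB.content_top, Ideal.mul_top, Ideal.span_singleton_eq_bot] at hspan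
  exact hr hspan

theorem mem_zdSet_of_mem_smul_top (hB : IsContentAlgebra R B) {I : Ideal R} {r : R} (hr0 : r ≠ 0)
    (hr : ∀ x ∈ I, r * x = 0) {f : B} (hf : f ∈ I • (⊤ : Submodule R B)) : f ∈ zdSet B :=
  ⟨algebraMap R B r, hB.algebraMap_ne_zero hr0, by
    rw [mul_comm, ← Algebra.smul_def, smul_eq_zero_of_mem_smul_top hr hf]⟩

/-- McCoy's theorem for content algebras. -/
theorem exists_mul_contentIdeal_eq_zero (hB : IsContentAlgebra R B) {f : B} (hf : f ∈ zdSet B) :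
    ∃ r : R, r ≠ 0 ∧ ∀ x ∈ contentIdeal R f, r * x = 0 := by
  classical
  obtain ⟨g, hg, hfg⟩ := hf
  have hex : ∃ n : ℕ, contentIdeal R f ^ n * contentIdeal R g = ⊥ := by
    obtain ⟨n, -, hn⟩ := hB.dedekind_mertens f g
    exact ⟨n, by rw [hn, hfg, contentIdeal_zero, Ideal.mul_bot]⟩
  obtain ⟨m, hm⟩ : ∃ m, Nat.find hex = m + 1 := by
    refine Nat.exists_eq_succ_of_ne_zero fun h => hB.contentIdeal_ne_bot hg ?_
    simpa [h] using Nat.find_spec hex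
  obtain ⟨r, hr, hr0⟩ := Submodule.exists_mem_ne_zero_of_ne_bot
    (Nat.find_min hex (m := m) (by omega))
  refine ⟨r, hr0, fun x hx => ?_⟩
  have hmem := Ideal.mul_mem_mul hr hx
  have hspec := Nat.find_spec hex
  rwa [mul_right_comm, ← pow_succ, ← hm, hspec, Ideal.mem_bot] at hmem

end IsContentAlgebra

/-- Let `B` be a content `R`-algebra whose content function is onto (every finitely
generated ideal of `R` is the content of some element of `B`). Then `B` is primal iff
`R` is primal and `R` has Property (A). -/
theorem primal_iff_primal_propertyA
    (R B : Type*) [CommRing R] [CommRing B] [Algebra R B]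
    (hB : IsContentAlgebra R B)
    (honto : ∀ I : Ideal R, I.FG → ∃ f : B, contentIdeal R f = I) :
    PrimalRing B ↔ (PrimalRing R ∧ PropertyA R) := by
  constructor
  · rintro ⟨P, hP⟩
    have hmemP {f : B} : f ∈ P ↔ f ∈ zdSet B := by rw [← hP, SetLike.mem_coe]
    refine ⟨⟨P.comap (algebraMap R B), Set.ext fun r => ?_⟩, fun I hI hIZ => ?_⟩
    · rw [SetLike.mem_coe, Ideal.mem_comap, hmemP, hB.algebraMap_mem_zdSet_iff]
    · obtain ⟨f, rfl⟩ := honto I hI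
      refine hB.exists_mul_contentIdeal_eq_zero (hmemP.mp ?_)
      have hf := hB.mem_content_smul f
      rw [Ideal.smul_top_eq_map, Submodule.restrictScalars_mem] at hf
      exact Ideal.map_le_iff_le_comap.mpr
        (fun x hx => hmemP.mpr (hB.algebraMap_mem_zdSet_iff.mpr (hIZ hx))) hf
  · rintro ⟨⟨Z, hZ⟩, hA⟩
    refine ⟨Z.map (algebraMap R B), Set.ext fun f => ?_⟩
    rw [SetLike.mem_coe, ← Submodule.restrictScalars_mem R, ← Ideal.smul_top_eq_map]
    constructor
    · intro hf
      obtain ⟨J, hJ, hJZ, hfJ⟩ := exists_fg_le_mem_smul_top hf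
      obtain ⟨r, hr0, hr⟩ := hA J hJ (hZ ▸ hJZ)
      exact hB.mem_zdSet_of_mem_smul_top hr0 hr hfJ
    · intro hf
      obtain ⟨r, hr0, hr⟩ := hB.exists_mul_contentIdeal_eq_zero hf
      refine Submodule.smul_mono_left (fun x hx => ?_) (hB.mem_content_smul f)
      rw [← SetLike.mem_coe, hZ]
      exact ⟨r, hr0, by rw [mul_comm, hr x hx]⟩
end
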